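/- arXiv:2203.01308 — 2 statements merged into one kernel-verified Lean document; each statement's English description precedes it below -/
import Mathlib

section
/- Evaluation of the unstructured sum-rate bound for the binary double dirty QMSTx: Consider the binary double dirty QMSTx of Example 1 with θ ∈ [0,π/2) and τ ∈ (0,1/2). Choose 𝒰₁=𝒰₂={0,1}, p_{U_j|S_j}(1|0)=p_{U_j|S_j}(0|1)=τ=1−p_{U_j|S_j}(0|0)=1−p_{U_j|S_j}(1|1) and X_j=U_j⊕S_j for j=1,2, and let σ be the corresponding classical-quantum state σ^{Y S₁S₂X₁X₂U₁U₂} = Σ p_S(s₁,s₂) p_{U₁|S₁}(u₁|s₁) p_{U₂|S₂}(u₂|s₂) 1{x_j=u_j⊕s_j} γ(x₁⊕x₂, s₁⊕s₂) ⊗ |x₁x₂u₁u₂s₁s₂⟩⟨·|. Then I(U₁,U₂;Y)_σ − I(U₁;S₁)_σ − I(U₂;S₂)_σ = α − 2 + 2h_b(τ), where α = h̃_b((1−2τ)² sin θ) − h̃_b(√(1−4ε(1−ε) sin²θ)) with ε = 2τ(1−τ). -/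
open scoped BigOperators
open Matrix Filter
open scoped ComplexOrder

noncomputable section
attribute [local instance] Classical.propDecidable

/-- `-(x log₂ x)`. -/
def nlog2 (x : ℝ) : ℝ := -(x * Real.logb 2 x)

/-- von Neumann entropy (base 2) of a matrix (0 if not Hermitian). -/
def matEnt2 {d : ℕ} (A : Matrix (Fin d) (Fin d) ℂ) : ℝ :=
  if h : A.IsHermitian then ∑ i, nlog2 (h.eigenvalues i) else 0

/-- marginal of a cq state over the classical index, grouping blocks along `f`. -/
def cqMarg {C C' : Type*} [Fintype C] {d : ℕ} (f : C → C')
    (σ : C → Matrix (Fin d) (Fin d) ℂ) : C' → Matrix (Fin d) (Fin d) ℂ :=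
  fun c' => ∑ c, if f c = c' then σ c else 0

/-- entropy (base 2) of a cq state (classical indices + quantum register). -/
def cqEnt2 {C : Type*} [Fintype C] {d : ℕ} (σ : C → Matrix (Fin d) (Fin d) ℂ) : ℝ :=
  ∑ c, matEnt2 (σ c)

/-- entropy (base 2) of the classical part (quantum register traced out). -/
def cEnt2 {C : Type*} [Fintype C] {d : ℕ} (σ : C → Matrix (Fin d) (Fin d) ℂ) : ℝ :=
  ∑ c, nlog2 ((σ c).trace.re)

/-- entropy (base 2) of the quantum register alone. -/
def entQ2 {C : Type*} [Fintype C] {d : ℕ} (σ : C → Matrix (Fin d) (Fin d) ℂ) : ℝ :=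
  matEnt2 (∑ c, σ c)

/-- `H(f(C))_σ` (base 2): entropy of a classical marginal (quantum traced out). -/
def margEntC2 {C C' : Type*} [Fintype C] [Fintype C'] {d : ℕ} (f : C → C')
    (σ : C → Matrix (Fin d) (Fin d) ℂ) : ℝ := cEnt2 (cqMarg f σ)

/-- `H(f(C), Y)_σ` (base 2): classical marginal together with the quantum register. -/
def margEntCQ2 {C C' : Type*} [Fintype C] [Fintype C'] {d : ℕ} (f : C → C')
    (σ : C → Matrix (Fin d) (Fin d) ℂ) : ℝ := cqEnt2 (cqMarg f σ)

/-- rank-one projector `|v⟩⟨v|`. -/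
def outer {d : ℕ} (v : Fin d → ℂ) : Matrix (Fin d) (Fin d) ℂ :=
  Matrix.of fun i j => v i * star (v j)

lemma outer_posSemidef {d : ℕ} (v : Fin d → ℂ) : (outer v).PosSemidef := by
  have h : outer v
      = (Matrix.of fun (_ : Fin 1) j => star (v j))ᴴ * (Matrix.of fun (_ : Fin 1) j => star (v j)) := by
    ext i j
    simp [outer, Matrix.mul_apply, Matrix.conjTranspose_apply, Fin.sum_univ_one]
  rw [h]
  exact Matrix.posSemidef_conjTranspose_mul_self _

/-- `|v_θ⟩ = (cos θ, sin θ)ᵀ`. -/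
def vth (θ : ℝ) : Fin 2 → ℂ := ![(Real.cos θ : ℂ), (Real.sin θ : ℂ)]
/-- `|v_θ^⊥⟩ = (sin θ, −cos θ)ᵀ`. -/
def vthp (θ : ℝ) : Fin 2 → ℂ := ![(Real.sin θ : ℂ), -(Real.cos θ : ℂ)]
def ket0 : Fin 2 → ℂ := ![1, 0]
def ket1 : Fin 2 → ℂ := ![0, 1]

lemma outer_trace {d : ℕ} (v : Fin d → ℂ) : (outer v).trace = ∑ i, v i * star (v i) := by
  simp [outer, Matrix.trace, Matrix.diag]

lemma trace_outer_vth (θ : ℝ) : (outer (vth θ)).trace = 1 := by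
  rw [outer_trace]
  simp only [vth, Fin.sum_univ_two, Matrix.cons_val_zero, Matrix.cons_val_one, Matrix.head_cons,
    Complex.star_def]
  rw [Complex.conj_ofReal, Complex.conj_ofReal]
  norm_cast
  nlinarith [Real.cos_sq_add_sin_sq θ]

lemma trace_outer_vthp (θ : ℝ) : (outer (vthp θ)).trace = 1 := by
  rw [outer_trace]
  simp only [vthp, Fin.sum_univ_two, Matrix.cons_val_zero, Matrix.cons_val_one, Matrix.head_cons,
    Complex.star_def, map_neg, Complex.conj_ofReal, mul_neg, neg_mul, neg_neg]
  norm_cast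
  nlinarith [Real.cos_sq_add_sin_sq θ]

lemma trace_outer_ket0 : (outer ket0).trace = 1 := by
  rw [outer_trace]; simp [ket0, Fin.sum_univ_two]

lemma trace_outer_ket1 : (outer ket1).trace = 1 := by
  rw [outer_trace]; simp [ket1, Fin.sum_univ_two]

/-- The density operators of Example 1: `γ(x₁⊕x₂, s₁⊕s₂)`. -/
def gammaEx (θ : ℝ) : Bool → Bool → Matrix (Fin 2) (Fin 2) ℂ :=
  fun w t =>
    match w, t with
    | false, false => outer ket0
    | false, true  => outer (vthp θ)
    | true,  false => outer ket1
    | true,  true  => outer (vth θ)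

lemma gammaEx_psd (θ : ℝ) (w t : Bool) : (gammaEx θ w t).PosSemidef := by
  cases w <;> cases t <;> exact outer_posSemidef _

lemma gammaEx_tr (θ : ℝ) (w t : Bool) : (gammaEx θ w t).trace = 1 := by
  cases w <;> cases t <;>
    simp [gammaEx, trace_outer_ket0, trace_outer_ket1, trace_outer_vth, trace_outer_vthp]

/-- Binary entropy function (base 2). -/
def hb (x : ℝ) : ℝ := -(x * Real.logb 2 x) - ((1 - x) * Real.logb 2 (1 - x))

/-- `h̃_b(x) = h_b(1/2 + x/2)`. -/
def htb (x : ℝ) : ℝ := hb (1/2 + x/2)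

/-- The quantity `α` of the paper: `α = h̃_b((1−2τ)² sin θ) − h̃_b(√(1−4ε(1−ε)sin²θ))`
with `ε = 2τ(1−τ)`. -/
def alphaEx (τ θ : ℝ) : ℝ :=
  htb ((1 - 2*τ)^2 * Real.sin θ)
    - htb (Real.sqrt (1 - 4 * (2*τ*(1-τ)) * (1 - 2*τ*(1-τ)) * (Real.sin θ)^2))

/-- The test cq state of Theorem 1 evaluated for Example 1 with the optimal IID choice:
`U_j = S_j ⊕ Z_j` with `Z_j ~ Ber(τ)` and `X_j = U_j ⊕ S_j`; classical registers
`(x₁,x₂,u₁,u₂,s₁,s₂)`. -/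
def sigma13 (θ τ : ℝ) :
    Bool × Bool × Bool × Bool × Bool × Bool → Matrix (Fin 2) (Fin 2) ℂ :=
  fun c => match c with
  | (x₁, x₂, u₁, u₂, s₁, s₂) =>
      (((1/4 : ℝ) * (if u₁ = s₁ then 1 - τ else τ) * (if u₂ = s₂ then 1 - τ else τ)
          * (if x₁ = xor u₁ s₁ then 1 else 0) * (if x₂ = xor u₂ s₂ then 1 else 0) : ℝ) : ℂ)
        • gammaEx θ (xor x₁ x₂) (xor s₁ s₂)

lemma nlog2_mul (p x : ℝ) : nlog2 (p * x) = x * nlog2 p + p * nlog2 x := by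
  unfold nlog2
  rcases eq_or_ne p 0 with rfl | hp
  · simp
  rcases eq_or_ne x 0 with rfl | hx
  · simp
  rw [Real.logb_mul hp hx]
  ring

lemma nlog2_one_half : nlog2 (1 / 2) = 1 / 2 := by
  simp [nlog2, Real.logb_inv]

lemma nlog2_one_fourth : nlog2 (1 / 4) = 1 / 2 := by
  rw [show (1 / 4 : ℝ) = 1 / 2 * (1 / 2) by norm_num, nlog2_mul, nlog2_one_half]
  norm_num

lemma nlog2_add_nlog2_one_sub (x : ℝ) : nlog2 x + nlog2 (1 - x) = hb x := by
  unfold nlog2 hb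
  ring

/-- The entropy of a `2 × 2` Hermitian matrix in terms of the roots of its characteristic
polynomial. -/
lemma matEnt2_eq_of_trace_det {A : Matrix (Fin 2) (Fin 2) ℂ} (hA : A.IsHermitian) {x y : ℝ}
    (htr : A.trace = ((x + y : ℝ) : ℂ)) (hdet : A.det = ((x * y : ℝ) : ℂ)) :
    matEnt2 A = nlog2 x + nlog2 y := by
  rw [matEnt2, dif_pos hA, Fin.sum_univ_two]
  have h₁ := hA.trace_eq_sum_eigenvalues
  have h₂ := hA.det_eq_prod_eigenvalues
  rw [htr, Fin.sum_univ_two] at h₁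
  rw [hdet, Fin.prod_univ_two] at h₂
  generalize hA.eigenvalues 0 = a at *
  generalize hA.eigenvalues 1 = b at *
  have hsum : x + y = a + b := by simpa using congrArg Complex.re h₁
  have hprod : x * y = a * b := by simpa using congrArg Complex.re h₂
  have h : (a - x) * (a - y) = 0 := by linear_combination hprod - a * hsum
  rcases mul_eq_zero.mp h with h | h
  · obtain rfl : a = x := by linarith
    obtain rfl : b = y := by linarith
    rfl
  · obtain rfl : a = y := by linarith
    obtain rfl : b = x := by linarith
    exact add_comm _ _

/-- The entropy of a real symmetric `2 × 2` matrix with trace `p` and Bloch vector of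
length `p * r`. -/
lemma matEnt2_real_symm {A : Matrix (Fin 2) (Fin 2) ℂ} {a b c p r : ℝ}
    (hA : A = !![(a : ℂ), (b : ℂ); (b : ℂ), (c : ℂ)])
    (htr : a + c = p) (hr : (a - c) ^ 2 + 4 * b ^ 2 = (p * r) ^ 2) :
    matEnt2 A = nlog2 p + p * htb r := by
  have hherm : A.IsHermitian := by
    subst hA
    ext i j
    fin_cases i <;> fin_cases j <;> simp
  rw [matEnt2_eq_of_trace_det hherm (x := p * (1 / 2 + r / 2)) (y := p * (1 - (1 / 2 + r / 2))),
    nlog2_mul, nlog2_mul, htb, ← nlog2_add_nlog2_one_sub]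
  · ring
  · rw [hA, Matrix.trace_fin_two_of, ← htr]
    push_cast
    ring
  · rw [hA, Matrix.det_fin_two_of]
    norm_cast
    subst htr
    linear_combination -hr / 4

lemma cqMarg_trace_re {C C' : Type*} [Fintype C] {d : ℕ} (f : C → C')
    (σ : C → Matrix (Fin d) (Fin d) ℂ) (c' : C') :
    (cqMarg f σ c').trace.re = ∑ c, if f c = c' then (σ c).trace.re else 0 := by
  rw [cqMarg, Matrix.trace_sum, Complex.re_sum]
  refine Finset.sum_congr rfl fun c _ => ?_
  split_ifs <;> simp

lemma sigma13_trace_re (θ τ : ℝ) (x₁ x₂ u₁ u₂ s₁ s₂ : Bool) :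
    (sigma13 θ τ (x₁, x₂, u₁, u₂, s₁, s₂)).trace.re =
      (1/4 : ℝ) * (if u₁ = s₁ then 1 - τ else τ) * (if u₂ = s₂ then 1 - τ else τ)
          * (if x₁ = xor u₁ s₁ then 1 else 0) * (if x₂ = xor u₂ s₂ then 1 else 0) := by
  rw [sigma13, Matrix.trace_smul, gammaEx_tr, smul_eq_mul, mul_one, Complex.ofReal_re]

lemma margEntC2_u₁u₂ (θ τ : ℝ) :
    margEntC2 (fun c => (c.2.2.1, c.2.2.2.1)) (sigma13 θ τ) = 2 := by
  have h (u : Bool × Bool) :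
      (cqMarg (fun c => (c.2.2.1, c.2.2.2.1)) (sigma13 θ τ) u).trace.re = 1 / 4 := by
    obtain ⟨u₁, u₂⟩ := u
    rw [cqMarg_trace_re]
    cases u₁ <;> cases u₂ <;>
      simp [Fintype.sum_prod_type, sigma13_trace_re] <;> ring
  simp only [margEntC2, cEnt2, h, nlog2_one_fourth]
  norm_num

lemma margEntC2_u₁ (θ τ : ℝ) :
    margEntC2 (fun c => c.2.2.1) (sigma13 θ τ) = 1 := by
  have h (b : Bool) : (cqMarg (fun c => c.2.2.1) (sigma13 θ τ) b).trace.re = 1 / 2 := by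
    rw [cqMarg_trace_re]
    cases b <;> simp [Fintype.sum_prod_type, sigma13_trace_re] <;> ring
  simp only [margEntC2, cEnt2, h, nlog2_one_half]
  norm_num

lemma margEntC2_u₂ (θ τ : ℝ) :
    margEntC2 (fun c => c.2.2.2.1) (sigma13 θ τ) = 1 := by
  have h (b : Bool) : (cqMarg (fun c => c.2.2.2.1) (sigma13 θ τ) b).trace.re = 1 / 2 := by
    rw [cqMarg_trace_re]
    cases b <;> simp [Fintype.sum_prod_type, sigma13_trace_re] <;> ring
  simp only [margEntC2, cEnt2, h, nlog2_one_half]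
  norm_num

lemma margEntC2_s₁ (θ τ : ℝ) :
    margEntC2 (fun c => c.2.2.2.2.1) (sigma13 θ τ) = 1 := by
  have h (b : Bool) : (cqMarg (fun c => c.2.2.2.2.1) (sigma13 θ τ) b).trace.re = 1 / 2 := by
    rw [cqMarg_trace_re]
    cases b <;> simp [Fintype.sum_prod_type, sigma13_trace_re] <;> ring
  simp only [margEntC2, cEnt2, h, nlog2_one_half]
  norm_num

lemma margEntC2_s₂ (θ τ : ℝ) :
    margEntC2 (fun c => c.2.2.2.2.2) (sigma13 θ τ) = 1 := by
  have h (b : Bool) : (cqMarg (fun c => c.2.2.2.2.2) (sigma13 θ τ) b).trace.re = 1 / 2 := by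
    rw [cqMarg_trace_re]
    cases b <;> simp [Fintype.sum_prod_type, sigma13_trace_re] <;> ring
  simp only [margEntC2, cEnt2, h, nlog2_one_half]
  norm_num

lemma sum_nlog2_half_mul (τ : ℝ) :
    ∑ c : Bool × Bool, nlog2 (1 / 2 * if c.1 = c.2 then 1 - τ else τ) = 1 + hb τ := by
  simp only [Fintype.sum_prod_type, Fintype.sum_bool, nlog2_mul, nlog2_one_half,
    ← nlog2_add_nlog2_one_sub, if_true, Bool.true_eq_false, Bool.false_eq_true, if_false]
  ring

lemma margEntC2_u₁s₁ (θ τ : ℝ) :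
    margEntC2 (fun c => (c.2.2.1, c.2.2.2.2.1)) (sigma13 θ τ) = 1 + hb τ := by
  have h (c' : Bool × Bool) : (cqMarg (fun c => (c.2.2.1, c.2.2.2.2.1)) (sigma13 θ τ) c').trace.re =
      1 / 2 * if c'.1 = c'.2 then 1 - τ else τ := by
    obtain ⟨u, s⟩ := c'
    rw [cqMarg_trace_re]
    cases u <;> cases s <;> simp [Fintype.sum_prod_type, sigma13_trace_re] <;> ring
  rw [margEntC2, cEnt2, ← sum_nlog2_half_mul]
  exact Finset.sum_congr rfl fun c _ => by rw [h]

lemma margEntC2_u₂s₂ (θ τ : ℝ) :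
    margEntC2 (fun c => (c.2.2.2.1, c.2.2.2.2.2)) (sigma13 θ τ) = 1 + hb τ := by
  have h (c' : Bool × Bool) : (cqMarg (fun c => (c.2.2.2.1, c.2.2.2.2.2)) (sigma13 θ τ) c').trace.re =
      1 / 2 * if c'.1 = c'.2 then 1 - τ else τ := by
    obtain ⟨u, s⟩ := c'
    rw [cqMarg_trace_re]
    cases u <;> cases s <;> simp [Fintype.sum_prod_type, sigma13_trace_re] <;> ring
  rw [margEntC2, cEnt2, ← sum_nlog2_half_mul]
  exact Finset.sum_congr rfl fun c _ => by rw [h]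

/-- Conditioned on `(u₁, u₂)`, the parity `s₁ ⊕ s₂` differs from `u₁ ⊕ u₂` with probability
`ε = 2τ(1-τ)`. -/
lemma cqMarg_sigma13_u₁u₂ (θ τ : ℝ) (u₁ u₂ : Bool) :
    cqMarg (fun c => (c.2.2.1, c.2.2.2.1)) (sigma13 θ τ) (u₁, u₂) =
      ((1 / 4 * (1 - 2 * τ * (1 - τ)) : ℝ) : ℂ) • gammaEx θ false (xor u₁ u₂) +
      ((1 / 4 * (2 * τ * (1 - τ)) : ℝ) : ℂ) • gammaEx θ true (!xor u₁ u₂) := by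
  cases u₁ <;> cases u₂ <;>
    · simp [cqMarg, Fintype.sum_prod_type, sigma13]
      module

lemma gammaEx_eq_of (θ : ℝ) (w t : Bool) :
    gammaEx θ w t =
      match w, t with
      | false, false => !![1, 0; 0, 0]
      | false, true => !![(Real.sin θ : ℂ) ^ 2, -(Real.sin θ * Real.cos θ : ℂ);
          -(Real.sin θ * Real.cos θ : ℂ), (Real.cos θ : ℂ) ^ 2]
      | true, false => !![0, 0; 0, 1]
      | true, true => !![(Real.cos θ : ℂ) ^ 2, (Real.sin θ * Real.cos θ : ℂ);
          (Real.sin θ * Real.cos θ : ℂ), (Real.sin θ : ℂ) ^ 2] := by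
  cases w <;> cases t <;> ext i j <;> fin_cases i <;> fin_cases j <;>
    simp [gammaEx, outer, ket0, ket1, vth, vthp,
      -Complex.ofReal_sin, -Complex.ofReal_cos] <;> ring

lemma matEnt2_cqMarg_sigma13_u₁u₂ (θ τ : ℝ) (u : Bool × Bool) :
    matEnt2 (cqMarg (fun c => (c.2.2.1, c.2.2.2.1)) (sigma13 θ τ) u) =
      1 / 2 + 1 / 4 *
        htb √(1 - 4 * (2*τ*(1-τ)) * (1 - 2*τ*(1-τ)) * (Real.sin θ)^2) := by
  obtain ⟨u₁, u₂⟩ := u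
  rw [cqMarg_sigma13_u₁u₂, ← nlog2_one_fourth]
  generalize xor u₁ u₂ = u
  generalize hε : 2 * τ * (1 - τ) = ε
  have hsq := Real.sin_sq_add_cos_sq θ
  have hnonneg : 0 ≤ 1 - 4 * ε * (1 - ε) * Real.sin θ ^ 2 := by
    nlinarith [mul_nonneg (sq_nonneg (1 - 2 * ε)) (sq_nonneg (Real.sin θ)), sq_nonneg (Real.cos θ)]
  have hr := Real.sq_sqrt hnonneg
  cases u
  · apply matEnt2_real_symm (a := 1 / 4 * (1 - ε) + 1 / 4 * ε * Real.cos θ ^ 2)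
      (b := 1 / 4 * ε * (Real.sin θ * Real.cos θ)) (c := 1 / 4 * ε * Real.sin θ ^ 2)
    · simp [gammaEx_eq_of]
    · linear_combination 1 / 4 * ε * hsq
    · simp only [mul_pow, hr, Real.cos_sq']
      ring
  · apply matEnt2_real_symm (a := 1 / 4 * (1 - ε) * Real.sin θ ^ 2)
      (b := -(1 / 4 * (1 - ε) * (Real.sin θ * Real.cos θ)))
      (c := 1 / 4 * (1 - ε) * Real.cos θ ^ 2 + 1 / 4 * ε)
    · simp [gammaEx_eq_of]
    · linear_combination 1 / 4 * (1 - ε) * hsq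
    · simp only [neg_sq, mul_pow, hr, Real.cos_sq']
      ring

lemma sum_cqMarg {C C' : Type*} [Fintype C] [Fintype C'] {d : ℕ} (f : C → C')
    (σ : C → Matrix (Fin d) (Fin d) ℂ) : ∑ c', cqMarg f σ c' = ∑ c, σ c := by
  simp only [cqMarg]
  rw [Finset.sum_comm]
  simp

lemma margEntCQ2_u₁u₂ (θ τ : ℝ) :
    margEntCQ2 (fun c => (c.2.2.1, c.2.2.2.1)) (sigma13 θ τ) =
      2 + htb √(1 - 4 * (2*τ*(1-τ)) * (1 - 2*τ*(1-τ)) * (Real.sin θ)^2) := by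
  rw [margEntCQ2, cqEnt2, Finset.sum_congr rfl fun u _ => matEnt2_cqMarg_sigma13_u₁u₂ θ τ u]
  simp only [Finset.sum_const, Finset.card_univ, Fintype.card_prod, Fintype.card_bool,
    nsmul_eq_mul]
  push_cast
  ring

lemma entQ2_sigma13 (θ τ : ℝ) :
    entQ2 (sigma13 θ τ) = htb ((1 - 2*τ)^2 * Real.sin θ) := by
  have hsq := Real.sin_sq_add_cos_sq θ
  have hone : nlog2 1 + 1 * htb ((1 - 2*τ)^2 * Real.sin θ) =
      htb ((1 - 2*τ)^2 * Real.sin θ) := by simp [nlog2]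
  rw [entQ2, ← sum_cqMarg (fun c => (c.2.2.1, c.2.2.2.1)), ← hone]
  apply matEnt2_real_symm
    (a := 1 / 2 * ((1 - 2 * τ * (1 - τ)) * (1 + Real.sin θ ^ 2) +
      2 * τ * (1 - τ) * Real.cos θ ^ 2))
    (b := -(1 / 2 * (1 - 2 * τ) ^ 2 * (Real.sin θ * Real.cos θ)))
    (c := 1 / 2 * ((1 - 2 * τ * (1 - τ)) * Real.cos θ ^ 2 +
      2 * τ * (1 - τ) * (1 + Real.sin θ ^ 2)))
  · simp only [Fintype.sum_prod_type, Fintype.sum_bool, cqMarg_sigma13_u₁u₂]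
    ext i j
    fin_cases i <;> fin_cases j <;> simp [gammaEx_eq_of] <;> ring
  · linear_combination 1 / 2 * hsq
  · simp only [neg_sq, mul_pow, Real.cos_sq']
    ring

/-- Evaluation of the unstructured sum-rate bound for the binary double dirty QMSTx:
`I(U₁,U₂;Y)_σ − I(U₁;S₁)_σ − I(U₂;S₂)_σ = α − 2 + 2 h_b(τ)`. -/
theorem unstructured_sum_rate_evaluation
    (θ τ : ℝ) (hθ : θ ∈ Set.Ico 0 (Real.pi/2)) (hτ : τ ∈ Set.Ioo (0:ℝ) (1/2)) :
    -- I(U₁,U₂;Y)_σ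
    ((margEntC2 (fun c => (c.2.2.1, c.2.2.2.1)) (sigma13 θ τ)
        + entQ2 (sigma13 θ τ)
        - margEntCQ2 (fun c => (c.2.2.1, c.2.2.2.1)) (sigma13 θ τ))
    -- − I(U₁;S₁)_σ
    - (margEntC2 (fun c => c.2.2.1) (sigma13 θ τ)
        + margEntC2 (fun c => c.2.2.2.2.1) (sigma13 θ τ)
        - margEntC2 (fun c => (c.2.2.1, c.2.2.2.2.1)) (sigma13 θ τ))
    -- − I(U₂;S₂)_σ
    - (margEntC2 (fun c => c.2.2.2.1) (sigma13 θ τ)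
        + margEntC2 (fun c => c.2.2.2.2.2) (sigma13 θ τ)
        - margEntC2 (fun c => (c.2.2.2.1, c.2.2.2.2.2)) (sigma13 θ τ)))
    = alphaEx τ θ - 2 + 2 * hb τ := by
  rw [margEntC2_u₁u₂, entQ2_sigma13, margEntCQ2_u₁u₂, margEntC2_u₁, margEntC2_s₁,
    margEntC2_u₁s₁, margEntC2_u₂, margEntC2_s₂, margEntC2_u₂s₂, alphaEx]
  ring
end
end

section
/- Linear coding achieves rate h_b(τ) on the classical binary doubly dirty MAC: Consider the classical MAC with binary inputs X₁,X₂, binary states S₁,S₂ drawn uniformly i.i.d. (state sequence S_j^n known non-causally only at encoder j), output Y = X₁⊕S₁⊕X₂⊕S₂, and per-sender average Hamming cost constraint τ ∈ (0,1/2) (the fraction of 1's in each input sequence must have expected value at most τ asymptotically). Then the rate pair (h_b(τ), 0) is achievable: for every δ > 0 there is a sequence of codes (encoders e_j:[M_j]×{0,1}^n→{0,1}^n and a decoder d:{0,1}^n→[M₁]×[M₂]) with (1/n) log₂ M₁ ≥ h_b(τ)−δ, M₂ = 1, average decoding error probability →0, and asymptotic average Hamming cost at most τ at each sender. In particular, since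 h_b(τ) > max{0, 2h_b(τ)−1} for all τ ∈ (0,1/2), the achievable sum rate exceeds the unstructured-coding sum-rate bound of Fact 1. -/
open scoped BigOperators
open Filter

noncomputable section
attribute [local instance] Classical.propDecidable

/-- The channel output sequence of the binary doubly dirty MAC:
`Y_t = X₁ₜ ⊕ S₁ₜ ⊕ X₂ₜ ⊕ S₂ₜ`. -/
def ddOutput {n : ℕ} (x₁ s₁ x₂ s₂ : Fin n → Bool) : Fin n → Bool :=
  fun t => xor (xor (x₁ t) (s₁ t)) (xor (x₂ t) (s₂ t))

/-- Average decoding error probability of a code for the binary doubly dirty MAC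
(uniform messages, uniform i.i.d. states known non-causally at the encoders). -/
def ddErr {n M₁ M₂ : ℕ}
    (e₁ : Fin M₁ → (Fin n → Bool) → (Fin n → Bool))
    (e₂ : Fin M₂ → (Fin n → Bool) → (Fin n → Bool))
    (dec : (Fin n → Bool) → Fin M₁ × Fin M₂) : ℝ :=
  (1 / ((M₁ : ℝ) * (M₂ : ℝ))) * ∑ m : Fin M₁ × Fin M₂,
    ∑ s : (Fin n → Bool) × (Fin n → Bool),
      ((1 : ℝ) / 2 ^ (2 * n)) *
        (if dec (ddOutput (e₁ m.1 s.1) s.1 (e₂ m.2 s.2) s.2) ≠ m then 1 else 0)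

/-- Expected normalized Hamming weight of the input of a sender. -/
def ddCost {n M : ℕ} (e : Fin M → (Fin n → Bool) → (Fin n → Bool)) : ℝ :=
  (1 / (M : ℝ)) * ∑ m : Fin M, ∑ s : Fin n → Bool,
    ((1 : ℝ) / 2 ^ n) * ((1 / (n : ℝ)) * ∑ t, (if e m s t then (1:ℝ) else 0))

/-! ### Greedy covering of a group of exponent two by the cosets of a small subgroup -/

/-- The elements `v` whose coset `v + C` misses `B`. -/
def uncovered {G : Type*} [AddCommGroup G] [Fintype G] (C : AddSubgroup G) (B : Finset G) :
    Finset G :=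
  Finset.univ.filter fun v => ∀ c ∈ C, v + c ∉ B

/-- Some translate of `U` meets `U` in at most the average number of points. -/
lemma exists_card_translate_inter_le {G : Type*} [AddCommGroup G] [Fintype G] (U : Finset G) :
    ∃ x : G, (U.filter fun v => v + x ∈ U).card * Fintype.card G ≤ U.card ^ 2 := by
  by_contra! h
  have hsum : ∑ x : G, (U.filter fun v => v + x ∈ U).card = U.card ^ 2 := by
    simp only [Finset.card_filter]
    rw [Finset.sum_comm]
    have hv (v : G) : ∑ x : G, (if v + x ∈ U then 1 else 0) = U.card := by
      refine (Equiv.sum_comp (Equiv.addLeft v) fun y => if y ∈ U then 1 else 0).trans ?_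
      simp
    simp [hv, sq]
  have hlt : ∑ _x : G, U.card ^ 2 <
      ∑ x : G, (U.filter fun v => v + x ∈ U).card * Fintype.card G :=
    Finset.sum_lt_sum_of_nonempty ⟨0, Finset.mem_univ _⟩ fun x _ => h x
  rw [← Finset.sum_mul, hsum] at hlt
  simp [mul_comm] at hlt

/-- In a group of exponent two, the subgroup generated by `C` and `x`. -/
def AddSubgroup.adjoin {G : Type*} [AddCommGroup G] (h2 : ∀ x : G, x + x = 0)
    (C : AddSubgroup G) (x : G) : AddSubgroup G where
  carrier := {g | g ∈ C ∨ g + x ∈ C}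
  zero_mem' := Or.inl C.zero_mem
  add_mem' := by
    rintro a b (ha | ha) (hb | hb)
    · exact Or.inl (C.add_mem ha hb)
    · right
      simpa [add_assoc] using C.add_mem ha hb
    · right
      simpa [add_right_comm] using C.add_mem ha hb
    · left
      have := C.add_mem ha hb
      rwa [add_add_add_comm, h2 x, add_zero] at this
  neg_mem' := by
    intro a ha
    rwa [neg_eq_of_add_eq_zero_left (h2 a)]

lemma AddSubgroup.card_adjoin_le {G : Type*} [AddCommGroup G] [Fintype G]
    (h2 : ∀ x : G, x + x = 0) (C : AddSubgroup G) (x : G) :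
    Nat.card (C.adjoin h2 x) ≤ 2 * Nat.card C := by
  have hsub : ((C.adjoin h2 x : AddSubgroup G) : Set G) ⊆ (C : Set G) ∪ Set.image (· + x) C := by
    rintro g (hg | hg)
    · exact Or.inl hg
    · exact Or.inr ⟨g + x, hg, by simp [add_assoc, h2]⟩
  have h₁ := Set.ncard_le_ncard hsub (Set.toFinite _)
  have h₃ := Set.ncard_union_le (C : Set G) (Set.image (· + x) C)
  have h₄ := Set.ncard_image_le (f := (· + x)) (Set.toFinite (C : Set G))
  rw [two_mul]
  exact h₁.trans (h₃.trans (Nat.add_le_add_left h₄ _))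

/-- Adjoining generators one at a time, the density of the uncovered set can be squared at
each step. -/
lemma exists_addSubgroup_uncovered_le {G : Type*} [AddCommGroup G] [Fintype G]
    (h2 : ∀ x : G, x + x = 0) (B : Finset G) (j : ℕ) :
    ∃ C : AddSubgroup G, Nat.card C ≤ 2 ^ j ∧
      ((uncovered C B).card : ℝ) / Fintype.card G ≤
        (1 - (B.card : ℝ) / Fintype.card G) ^ 2 ^ j := by
  have hG : (0 : ℝ) < Fintype.card G := by exact_mod_cast Fintype.card_pos
  induction j with
  | zero =>
    refine ⟨⊥, by simp, ?_⟩
    have hB : uncovered (⊥ : AddSubgroup G) B = Bᶜ := by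
      ext v
      simp [uncovered]
    rw [hB, Finset.card_compl, Nat.cast_sub (Finset.card_le_univ B), pow_zero, pow_one, sub_div,
      div_self hG.ne']
  | succ j ih =>
    obtain ⟨C, hC, hU⟩ := ih
    obtain ⟨x, hx⟩ := exists_card_translate_inter_le (uncovered C B)
    refine ⟨C.adjoin h2 x, (C.card_adjoin_le h2 x).trans (by rw [pow_succ]; omega), ?_⟩
    have hsub : uncovered (C.adjoin h2 x) B ⊆
        (uncovered C B).filter fun v => v + x ∈ uncovered C B := by
      intro v hv
      simp only [uncovered, Finset.mem_filter, Finset.mem_univ, true_and] at hv ⊢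
      refine ⟨fun c hc => hv c (Or.inl hc), fun c hc => ?_⟩
      rw [add_assoc]
      exact hv _ (Or.inr (by rwa [add_right_comm, h2, zero_add]))
    have hcard : ((uncovered (C.adjoin h2 x) B).card : ℝ) * Fintype.card G ≤
        ((uncovered C B).card : ℝ) ^ 2 := by
      exact_mod_cast (Nat.mul_le_mul_right _ (Finset.card_le_card hsub)).trans hx
    calc ((uncovered (C.adjoin h2 x) B).card : ℝ) / Fintype.card G
        ≤ (((uncovered C B).card : ℝ) / Fintype.card G) ^ 2 := by
          rw [div_pow, div_le_div_iff₀ hG (by positivity)]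
          nlinarith
      _ ≤ ((1 - (B.card : ℝ) / Fintype.card G) ^ 2 ^ j) ^ 2 := by gcongr
      _ = _ := by rw [← pow_mul, ← pow_succ]

/-! ### The volume of Hamming balls -/

/-- The Hamming ball of radius `r` in `𝔽₂ⁿ`. -/
def binaryBall (n r : ℕ) : Finset (Fin n → ZMod 2) :=
  Finset.univ.filter fun v => hammingNorm v ≤ r

lemma choose_le_card_binaryBall (n r : ℕ) : n.choose r ≤ (binaryBall n r).card := by
  have h : ((Finset.univ : Finset (Fin n)).powersetCard r).card = n.choose r := by simp
  rw [← h]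
  refine Finset.card_le_card_of_injOn (fun S t => if t ∈ S then 1 else 0) ?_ ?_
  · intro S hS
    have hS' : S.card = r := by simpa using hS
    simp [binaryBall, hammingNorm, hS']
  · intro S _ T _ hST
    ext t
    have := congrFun hST t
    by_cases hs : t ∈ S <;> by_cases ht : t ∈ T <;> simp_all

/-- The probability of `k` successes in `n` trials is largest at the mode `⌊(n + 1) p⌋`. -/
lemma binomial_le_mode {p : ℝ} (hp : 0 < p) (hp1 : p < 1) (n k : ℕ) :
    (n.choose k : ℝ) * p ^ k * (1 - p) ^ (n - k) ≤
      n.choose ⌊(n + 1) * p⌋₊ * p ^ ⌊(n + 1) * p⌋₊ * (1 - p) ^ (n - ⌊(n + 1) * p⌋₊) := by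
  have hq : 0 < 1 - p := by linarith
  set a : ℕ → ℝ := fun k => (n.choose k : ℝ) * p ^ k * (1 - p) ^ (n - k) with ha
  have ha0 (k : ℕ) : 0 ≤ a k := by positivity
  set r := ⌊(n + 1) * p⌋₊ with hr
  have hr_le : (r : ℝ) ≤ (n + 1) * p := Nat.floor_le (by positivity)
  have hr_lt : (n + 1) * p < r + 1 := Nat.lt_floor_add_one _
  have hrec (k : ℕ) (hk : k < n) :
      (k + 1) * (1 - p) * a (k + 1) = (n - k) * p * a k := by
    have hc : (n.choose (k + 1) : ℝ) * (k + 1) = n.choose k * (n - k) := by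
      have := Nat.choose_succ_right_eq n k
      rw [← Nat.cast_sub hk.le]
      exact_mod_cast this
    have he : n - k = n - (k + 1) + 1 := by omega
    simp only [ha]
    rw [he, pow_succ, pow_succ]
    linear_combination p ^ k * p * (1 - p) ^ (n - (k + 1)) * (1 - p) * hc
  have hup (k : ℕ) (hk : k < r) : a k ≤ a (k + 1) := by
    have hkr : (k : ℝ) + 1 ≤ r := by exact_mod_cast hk
    have hkn : k < n := by
      have : (k : ℝ) + 1 < n + 1 := by nlinarith [(Nat.cast_nonneg n : (0 : ℝ) ≤ n)]
      exact_mod_cast (by linarith : (k : ℝ) < n)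
    refine le_of_mul_le_mul_left ?_ (by positivity : 0 < (k + 1) * (1 - p))
    rw [hrec k hkn]
    exact mul_le_mul_of_nonneg_right (by nlinarith) (ha0 k)
  have hdown (k : ℕ) (hk : r ≤ k) : a (k + 1) ≤ a k := by
    rcases lt_or_ge k n with hkn | hkn
    · have hkr : (r : ℝ) ≤ k := by exact_mod_cast hk
      refine le_of_mul_le_mul_left ?_ (by positivity : 0 < (k + 1) * (1 - p))
      rw [hrec k hkn]
      exact mul_le_mul_of_nonneg_right (by nlinarith) (ha0 k)
    · have : a (k + 1) = 0 := by simp [ha, Nat.choose_eq_zero_of_lt (Nat.lt_succ_of_le hkn)]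
      rw [this]
      exact ha0 k
  change a k ≤ a r
  rcases le_total k r with hk | hk
  · refine Nat.decreasingInduction (motive := fun m _ => a m ≤ a r) ?_ le_rfl hk
    exact fun m hm ih => (hup m hm).trans ih
  · induction k, hk using Nat.le_induction with
    | base => exact le_rfl
    | succ m hm ih => exact (hdown m hm).trans ih

lemma one_le_succ_mul_binomial_mode {p : ℝ} (hp : 0 < p) (hp1 : p < 1) (n : ℕ) :
    1 ≤ ((n : ℝ) + 1) * (n.choose ⌊(n + 1) * p⌋₊ * p ^ ⌊(n + 1) * p⌋₊ *
      (1 - p) ^ (n - ⌊(n + 1) * p⌋₊)) := by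
  have hsum := add_pow p (1 - p) n
  rw [add_sub_cancel, one_pow] at hsum
  calc (1 : ℝ) = ∑ k ∈ Finset.range (n + 1), (n.choose k : ℝ) * p ^ k * (1 - p) ^ (n - k) :=
        hsum.trans (Finset.sum_congr rfl fun k _ => by ring)
    _ ≤ ∑ _k ∈ Finset.range (n + 1), (n.choose ⌊(n + 1) * p⌋₊ * p ^ ⌊(n + 1) * p⌋₊ *
          (1 - p) ^ (n - ⌊(n + 1) * p⌋₊)) :=
        Finset.sum_le_sum fun k _ => binomial_le_mode hp hp1 n k
    _ = _ := by simp

lemma logb_card_binaryBall_ge {p : ℝ} (hp : 0 < p) (hp1 : p < 1 / 2) (n : ℕ) :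
    n * hb p - Real.logb 2 (n + 1) - (Real.logb 2 (1 - p) - Real.logb 2 p) ≤
      Real.logb 2 (binaryBall n ⌊(n + 1) * p⌋₊).card := by
  have hq : 0 < 1 - p := by linarith
  set r := ⌊(n + 1) * p⌋₊ with hr
  have hr_lt : (n + 1) * p < r + 1 := Nat.lt_floor_add_one _
  have hrn : r ≤ n := by
    refine Nat.lt_succ_iff.mp ((Nat.floor_lt (by positivity)).mpr ?_)
    push_cast
    nlinarith [(Nat.cast_nonneg n : (0 : ℝ) ≤ n)]
  have hV : (0 : ℝ) < n.choose r := by exact_mod_cast Nat.choose_pos hrn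
  have h₁ := Real.logb_le_logb_of_le one_lt_two one_pos
    (one_le_succ_mul_binomial_mode hp (by linarith) n)
  rw [← hr, Real.logb_one, Real.logb_mul (by positivity) (by positivity),
    Real.logb_mul (by positivity) (by positivity), Real.logb_mul (by positivity) (by positivity),
    Real.logb_pow, Real.logb_pow, Nat.cast_sub hrn] at h₁
  have h₂ : Real.logb 2 (n.choose r) ≤ Real.logb 2 (binaryBall n r).card :=
    Real.logb_le_logb_of_le one_lt_two hV (by exact_mod_cast choose_le_card_binaryBall n r)
  have h₃ : 0 ≤ Real.logb 2 (1 - p) - Real.logb 2 p :=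
    sub_nonneg.mpr (Real.logb_le_logb_of_le one_lt_two hp (by linarith))
  have h₄ : 0 ≤ (r + 1 - n * p) * (Real.logb 2 (1 - p) - Real.logb 2 p) :=
    mul_nonneg (by nlinarith) h₃
  unfold hb
  nlinarith

/-! ### Syndrome coding -/

/-- Binary words as vectors over `𝔽₂`. -/
def wordEquiv (n : ℕ) : (Fin n → Bool) ≃ (Fin n → ZMod 2) :=
  Equiv.piCongrRight fun _ => finTwoEquiv.symm

lemma wordEquiv_ddOutput {n : ℕ} (x₁ s₁ x₂ s₂ : Fin n → Bool) :
    wordEquiv n (ddOutput x₁ s₁ x₂ s₂) =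
      wordEquiv n x₁ + wordEquiv n s₁ + (wordEquiv n x₂ + wordEquiv n s₂) := by
  have key : ∀ a b c d : Bool, (finTwoEquiv.symm (xor (xor a b) (xor c d)) : ZMod 2) =
      (finTwoEquiv.symm a : ZMod 2) + (finTwoEquiv.symm b : ZMod 2) +
        ((finTwoEquiv.symm c : ZMod 2) + (finTwoEquiv.symm d : ZMod 2)) := by
    decide
  exact funext fun t => key _ _ _ _

lemma sum_wordEquiv_symm {n : ℕ} (v : Fin n → ZMod 2) :
    (∑ t, if (wordEquiv n).symm v t then (1 : ℝ) else 0) = hammingNorm v := by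
  have key : ∀ a : ZMod 2, finTwoEquiv a = true ↔ a ≠ 0 := by
    intro a
    fin_cases a
    · exact iff_of_false Bool.false_ne_true fun h => h rfl
    · exact iff_of_true rfl (one_ne_zero (α := ZMod 2))
  rw [hammingNorm, Finset.card_filter]
  push_cast
  refine Finset.sum_congr rfl fun t _ => ?_
  have := key (v t)
  change (if finTwoEquiv (v t) = true then (1 : ℝ) else 0) = _
  by_cases h : v t = 0 <;> simp_all

lemma zmod_two_pi_add_self {n : ℕ} (v : Fin n → ZMod 2) : v + v = 0 :=
  funext fun t => CharTwo.add_self_eq_zero (v t)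

/-- A choice of light coset representatives. -/
lemma exists_coset_leader {n : ℕ} (C : AddSubgroup (Fin n → ZMod 2)) (r : ℕ) :
    ∃ L : (Fin n → ZMod 2) → (Fin n → ZMod 2),
      (∀ v, (QuotientAddGroup.mk (L v) : (Fin n → ZMod 2) ⧸ C) = QuotientAddGroup.mk v) ∧
      ∀ v, (hammingNorm (L v) : ℝ) ≤
        r + if v ∈ uncovered C (binaryBall n r) then (n : ℝ) else 0 := by
  have h (v : Fin n → ZMod 2) : ∃ w : Fin n → ZMod 2,
      (QuotientAddGroup.mk w : (Fin n → ZMod 2) ⧸ C) = QuotientAddGroup.mk v ∧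
      (hammingNorm w : ℝ) ≤ r + if v ∈ uncovered C (binaryBall n r) then (n : ℝ) else 0 := by
    by_cases hv : v ∈ uncovered C (binaryBall n r)
    · refine ⟨v, rfl, ?_⟩
      have : (hammingNorm v : ℝ) ≤ n := by
        exact_mod_cast (hammingNorm_le_card_fintype (x := v)).trans_eq (Fintype.card_fin n)
      rw [if_pos hv]
      linarith [(Nat.cast_nonneg r : (0 : ℝ) ≤ r)]
    · have hv' := hv
      simp only [uncovered, binaryBall, Finset.mem_filter, Finset.mem_univ, true_and, not_forall,
        not_not] at hv'
      obtain ⟨c, hc, hw⟩ := hv'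
      refine ⟨v + c, QuotientAddGroup.mk_add_of_mem v hc, ?_⟩
      rw [if_neg hv, add_zero]
      exact_mod_cast hw
  choose L hL₁ hL₂ using h
  exact ⟨L, hL₁, hL₂⟩

lemma ddCost_le {n M : ℕ} (e : Fin M → (Fin n → Bool) → (Fin n → Bool))
    (a : Fin M → (Fin n → ZMod 2)) (L : (Fin n → ZMod 2) → (Fin n → ZMod 2))
    (he : ∀ m s, e m s = (wordEquiv n).symm (L (a m + wordEquiv n s)))
    (U : Finset (Fin n → ZMod 2)) (r : ℕ)
    (hL : ∀ v, (hammingNorm (L v) : ℝ) ≤ r + if v ∈ U then (n : ℝ) else 0) :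
    ddCost e ≤ (r : ℝ) / n + (U.card : ℝ) / 2 ^ n := by
  have hper (m : Fin M) : ∑ s : Fin n → Bool,
      ((1 : ℝ) / 2 ^ n) * ((1 / (n : ℝ)) * ∑ t, (if e m s t then (1 : ℝ) else 0)) ≤
        (r : ℝ) / n + (U.card : ℝ) / 2 ^ n := by
    simp only [he, sum_wordEquiv_symm]
    refine (Equiv.sum_comp ((wordEquiv n).trans (Equiv.addLeft (a m)))
      fun v => ((1 : ℝ) / 2 ^ n) * ((1 / (n : ℝ)) * hammingNorm (L v))).trans_le ?_
    calc ∑ v, ((1 : ℝ) / 2 ^ n) * ((1 / (n : ℝ)) * hammingNorm (L v))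
        ≤ ∑ v, ((1 : ℝ) / 2 ^ n) * ((1 / (n : ℝ)) * (r + if v ∈ U then (n : ℝ) else 0)) := by
          gcongr with v
          exact hL v
      _ = (r : ℝ) / n + ((n : ℝ) / n) * (U.card / 2 ^ n) := by
          rw [← Finset.mul_sum, ← Finset.mul_sum, Finset.sum_add_distrib]
          simp only [Finset.sum_const, Finset.card_univ, Fintype.card_pi, ZMod.card,
            Finset.prod_const, Fintype.card_fin, Finset.sum_ite_mem, Finset.univ_inter,
            nsmul_eq_mul, Nat.cast_pow, Nat.cast_ofNat]
          field_simp
      _ ≤ (r : ℝ) / n + 1 * (U.card / 2 ^ n) := by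
          gcongr
          exact div_self_le_one _
      _ = _ := by rw [one_mul]
  have hbound : 0 ≤ (r : ℝ) / n + (U.card : ℝ) / 2 ^ n := by positivity
  calc ddCost e ≤ (1 / (M : ℝ)) * ∑ _m : Fin M, ((r : ℝ) / n + (U.card : ℝ) / 2 ^ n) :=
        mul_le_mul_of_nonneg_left (Finset.sum_le_sum fun m _ => hper m) (by positivity)
    _ = ((M : ℝ) / M) * ((r : ℝ) / n + (U.card : ℝ) / 2 ^ n) := by
        simp only [Finset.sum_const, Finset.card_univ, Fintype.card_fin, nsmul_eq_mul]
        ring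
    _ ≤ _ := mul_le_of_le_one_left hbound (div_self_le_one _)

/-- A linear code turns into an error-free code for the doubly dirty MAC, whose messages are the
cosets and whose cost is governed by the covering properties of the linear code. -/
lemma exists_syndrome_code {n : ℕ} (C : AddSubgroup (Fin n → ZMod 2)) (r : ℕ) :
    ∃ (M : ℕ) (e₁ : Fin M → (Fin n → Bool) → (Fin n → Bool))
      (e₂ : Fin 1 → (Fin n → Bool) → (Fin n → Bool))
      (dec : (Fin n → Bool) → Fin M × Fin 1),
      2 ^ n = M * Nat.card C ∧ ddErr e₁ e₂ dec = 0 ∧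
      ddCost e₁ ≤ (r : ℝ) / n + ((uncovered C (binaryBall n r)).card : ℝ) / 2 ^ n ∧
      ddCost e₂ ≤ (r : ℝ) / n + ((uncovered C (binaryBall n r)).card : ℝ) / 2 ^ n := by
  obtain ⟨L, hL₁, hL₂⟩ := exists_coset_leader C r
  set E := Finite.equivFin ((Fin n → ZMod 2) ⧸ C)
  refine ⟨Nat.card ((Fin n → ZMod 2) ⧸ C),
    fun m s => (wordEquiv n).symm (L ((E.symm m).out + wordEquiv n s)),
    fun _ s => (wordEquiv n).symm (L (0 + wordEquiv n s)),
    fun y => (E (QuotientAddGroup.mk (wordEquiv n y)), 0), ?_, ?_, ?_, ?_⟩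
  · rw [← AddSubgroup.card_eq_card_quotient_mul_card_addSubgroup C]
    simp
  · unfold ddErr
    rw [Finset.sum_eq_zero, mul_zero]
    rintro ⟨m, i⟩ -
    refine Finset.sum_eq_zero ?_
    rintro ⟨s₁, s₂⟩ -
    rw [if_neg, mul_zero]
    rw [not_not]
    refine Prod.ext ?_ (Subsingleton.elim _ _)
    rw [← Equiv.eq_symm_apply]
    dsimp only
    rw [wordEquiv_ddOutput]
    simp only [Equiv.apply_symm_apply, QuotientAddGroup.mk_add, hL₁]
    simp only [← QuotientAddGroup.mk_add, add_assoc, zmod_two_pi_add_self, add_zero, zero_add]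
    exact QuotientAddGroup.out_eq' _
  · exact ddCost_le _ (fun m => (E.symm m).out) L (fun _ _ => rfl) _ r hL₂
  · exact ddCost_le _ (fun _ => 0) L (fun _ _ => rfl) _ r hL₂

lemma one_sub_pow_le_inv {x : ℝ} (hx : 0 < x) (hx1 : x ≤ 1) {k : ℕ} (hk : 0 < k) :
    (1 - x) ^ k ≤ (k * x)⁻¹ := by
  have hk' : (0 : ℝ) < k := by exact_mod_cast hk
  calc (1 - x) ^ k ≤ Real.exp (-x) ^ k :=
        pow_le_pow_left₀ (by linarith) (by linarith [Real.add_one_le_exp (-x)]) k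
    _ = (Real.exp (k * x))⁻¹ := by rw [← Real.exp_nat_mul, ← Real.exp_neg]; ring_nf
    _ ≤ (k * x)⁻¹ := by
        gcongr
        linarith [Real.add_one_le_exp (k * x)]

/-- For every block length and every number `j` of generators there is an error-free code losing
at most `j` message bits, with an explicit bound on its cost. -/
lemma exists_code_cost_le {p : ℝ} (hp : 0 < p) (hp1 : p < 1 / 2) (n j : ℕ) :
    ∃ (M : ℕ) (e₁ : Fin M → (Fin n → Bool) → (Fin n → Bool))
      (e₂ : Fin 1 → (Fin n → Bool) → (Fin n → Bool))
      (dec : (Fin n → Bool) → Fin M × Fin 1),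
      (n : ℝ) - j ≤ Real.logb 2 M ∧ ddErr e₁ e₂ dec = 0 ∧
      ∀ b : ℝ, b = ((n : ℝ) + 1) * p / n + (2 : ℝ) ^ (-(j - n + n * hb p - Real.logb 2 (n + 1) -
        (Real.logb 2 (1 - p) - Real.logb 2 p))) → ddCost e₁ ≤ b ∧ ddCost e₂ ≤ b := by
  set r := ⌊(n + 1) * p⌋₊ with hr
  have hr_le : (r : ℝ) ≤ (n + 1) * p := Nat.floor_le (by positivity)
  obtain ⟨C, hC, hU⟩ := exists_addSubgroup_uncovered_le
    (zmod_two_pi_add_self (n := n)) (binaryBall n r) j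
  obtain ⟨M, e₁, e₂, dec, hM, herr, hc₁, hc₂⟩ := exists_syndrome_code C r
  have hcard : (Fintype.card (Fin n → ZMod 2) : ℝ) = 2 ^ n := by simp
  have hB0 : (0 : ℝ) < (binaryBall n r).card := by
    exact_mod_cast Finset.card_pos.mpr ⟨0, by simp [binaryBall]⟩
  have hB1 : ((binaryBall n r).card : ℝ) ≤ 2 ^ n := by
    rw [← hcard]
    exact_mod_cast Finset.card_le_univ _
  rw [hcard] at hU
  have hx : (2 : ℝ) ^ (j - n + n * hb p - Real.logb 2 (n + 1) -
      (Real.logb 2 (1 - p) - Real.logb 2 p)) ≤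
      ((2 ^ j : ℕ) : ℝ) * ((binaryBall n r).card / 2 ^ n) := by
    rw [← Real.le_logb_iff_rpow_le one_lt_two (by positivity),
      Real.logb_mul (by positivity) (by positivity), Real.logb_div (by positivity) (by positivity)]
    push_cast
    rw [Real.logb_pow, Real.logb_pow, Real.logb_self_eq_one one_lt_two]
    linarith [logb_card_binaryBall_ge hp hp1 n]
  have hu := hU.trans <| (one_sub_pow_le_inv (by positivity)
    ((div_le_one (by positivity)).mpr hB1) (k := 2 ^ j) (by positivity)).trans
      (inv_anti₀ (by positivity) hx)
  rw [← Real.rpow_neg zero_le_two] at hu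
  have hbound := add_le_add (div_le_div_of_nonneg_right hr_le (Nat.cast_nonneg n)) hu
  refine ⟨M, e₁, e₂, dec, ?_, herr, ?_⟩
  · have hle : 2 ^ n ≤ M * 2 ^ j := hM.le.trans (Nat.mul_le_mul_left _ hC)
    have hM0 : (0 : ℝ) < M := by
      refine Nat.cast_pos.mpr (Nat.pos_of_ne_zero ?_)
      rintro rfl
      simp at hM
    have hle' : (2 : ℝ) ^ n ≤ M * 2 ^ j := by exact_mod_cast hle
    have := Real.logb_le_logb_of_le one_lt_two (by positivity) hle'
    rw [Real.logb_mul hM0.ne' (by positivity), Real.logb_pow, Real.logb_pow,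
      Real.logb_self_eq_one one_lt_two] at this
    linarith
  · rintro b rfl
    exact ⟨hc₁.trans hbound, hc₂.trans hbound⟩

/-! ### Asymptotics -/

lemma hb_eq_binEntropy_div (x : ℝ) : hb x = Real.binEntropy x / Real.log 2 := by
  simp only [hb, Real.binEntropy, Real.logb, Real.log_inv]
  ring

lemma ddCost_nonneg {n M : ℕ} (e : Fin M → (Fin n → Bool) → (Fin n → Bool)) : 0 ≤ ddCost e := by
  unfold ddCost
  positivity

lemma limsup_le_of_le_of_tendsto {u v : ℕ → ℝ} {a : ℝ} (h0 : ∀ n, 0 ≤ u n) (huv : ∀ n, u n ≤ v n)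
    (hv : Tendsto v atTop (nhds a)) : limsup u atTop ≤ a := by
  rw [← hv.limsup_eq]
  exact limsup_le_limsup (Eventually.of_forall huv)
    (IsCoboundedUnder.of_frequently_ge (a := 0) (Frequently.of_forall h0)) hv.isBoundedUnder_le

lemma tendsto_logb_succ_div_atTop :
    Tendsto (fun n : ℕ => Real.logb 2 ((n : ℝ) + 1) / n) atTop (nhds 0) := by
  have h₁ : Tendsto (fun n : ℕ => Real.log ((n : ℝ) + 1) / (1 * ((n : ℝ) + 1) + (-1))) atTop
      (nhds 0) := by
    have := Real.tendsto_pow_log_div_mul_add_atTop 1 (-1) 1 one_ne_zero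
    simp only [pow_one] at this
    exact this.comp (tendsto_atTop_add_const_right _ 1 tendsto_natCast_atTop_atTop)
  have h₂ := h₁.div_const (Real.log 2)
  rw [zero_div] at h₂
  refine h₂.congr fun n => ?_
  rw [Real.logb, div_right_comm]
  congr 2
  ring

/-- The cost bound of `exists_code_cost_le` tends to `p` once the number of generators exceeds
`n (1 - h_b(p))` by a linear amount. -/
lemma tendsto_cost_bound (p c : ℝ) {δ : ℝ} (hδ : 0 < δ) (j : ℕ → ℕ)
    (hj : ∀ n : ℕ, n * (1 - hb p + δ) ≤ j n) :
    Tendsto (fun n : ℕ => ((n : ℝ) + 1) * p / n +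
      (2 : ℝ) ^ (-(j n - n + n * hb p - Real.logb 2 (n + 1) - c))) atTop (nhds p) := by
  have h₁ : Tendsto (fun n : ℕ => ((n : ℝ) + 1) * p / n) atTop (nhds p) := by
    have := (tendsto_const_nhds (x := p)).add (tendsto_const_div_atTop_nhds_zero_nat p)
    rw [add_zero] at this
    refine this.congr' ?_
    filter_upwards [eventually_gt_atTop 0] with n hn
    have : (n : ℝ) ≠ 0 := by exact_mod_cast hn.ne'
    field_simp
  have h₂ : Tendsto (fun n : ℕ => (n : ℝ) * (δ - Real.logb 2 (n + 1) / n - c / n)) atTop atTop := by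
    refine tendsto_natCast_atTop_atTop.atTop_mul_pos hδ ?_
    simpa using ((tendsto_const_nhds (x := δ)).sub tendsto_logb_succ_div_atTop).sub
      (tendsto_const_div_atTop_nhds_zero_nat c)
  have h₃ : Tendsto (fun n : ℕ => (j n : ℝ) - n + n * hb p - Real.logb 2 (n + 1) - c)
      atTop atTop := by
    refine tendsto_atTop_mono' _ ?_ h₂
    filter_upwards [eventually_gt_atTop 0] with n hn
    have hn' : (n : ℝ) ≠ 0 := by exact_mod_cast hn.ne'
    have : (n : ℝ) * (δ - Real.logb 2 (n + 1) / n - c / n) =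
        n * δ - Real.logb 2 (n + 1) - c := by field_simp
    rw [this]
    linarith [hj n]
  have h₄ : Tendsto (fun n : ℕ => (2 : ℝ) ^ (-(j n - n + n * hb p - Real.logb 2 (n + 1) - c)))
      atTop (nhds 0) := by
    exact (tendsto_rpow_atBot_of_base_gt_one 2 one_lt_two).comp (tendsto_neg_atTop_atBot.comp h₃)
  simpa using h₁.add h₄

/-- Linear coding achieves the rate pair `(h_b(τ), 0)` on the classical binary doubly
dirty MAC under per-sender Hamming cost `τ ∈ (0, 1/2)`; in particular, since
`h_b(τ) > max{0, 2 h_b(τ) − 1}`, this exceeds the unstructured sum-rate bound of Fact 1. -/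
theorem linear_coding_doubly_dirty_MAC (τ : ℝ) (hτ : τ ∈ Set.Ioo (0:ℝ) (1/2)) :
    (∀ δ > (0:ℝ),
      ∃ (M₁ : ℕ → ℕ)
        (e₁ : ∀ n, Fin (M₁ n) → (Fin n → Bool) → (Fin n → Bool))
        (e₂ : ∀ n, Fin 1 → (Fin n → Bool) → (Fin n → Bool))
        (dec : ∀ n, (Fin n → Bool) → Fin (M₁ n) × Fin 1),
        (∀ᶠ n in atTop, Real.logb 2 (M₁ n) / (n : ℝ) ≥ hb τ - δ) ∧
        Tendsto (fun n => ddErr (e₁ n) (e₂ n) (dec n)) atTop (nhds 0) ∧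
        Filter.limsup (fun n => ddCost (e₁ n)) atTop ≤ τ ∧
        Filter.limsup (fun n => ddCost (e₂ n)) atTop ≤ τ)
    ∧ hb τ > max 0 (2 * hb τ - 1) := by
  obtain ⟨hτ0, hτ1⟩ := hτ
  have hlog : 0 < Real.log 2 := Real.log_pos one_lt_two
  have hpos : 0 < hb τ := by
    rw [hb_eq_binEntropy_div]
    exact div_pos (Real.binEntropy_pos hτ0 (by linarith)) hlog
  have hlt : hb τ < 1 := by
    rw [hb_eq_binEntropy_div, div_lt_one hlog]
    exact Real.binEntropy_lt_log_two.mpr (by norm_num; linarith)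
  refine ⟨fun δ hδ => ?_, max_lt hpos (by linarith)⟩
  set j : ℕ → ℕ := fun n => ⌈(n : ℝ) * (1 - hb τ + δ / 2)⌉₊ with hj
  choose M e₁ e₂ dec hM herr hcost using fun n => exists_code_cost_le hτ0 hτ1 n (j n)
  have hlim := tendsto_cost_bound τ (Real.logb 2 (1 - τ) - Real.logb 2 τ) (half_pos hδ) j
    fun n => Nat.le_ceil _
  refine ⟨M, e₁, e₂, dec, ?_, ?_,
    limsup_le_of_le_of_tendsto (fun n => ddCost_nonneg _) (fun n => (hcost n _ rfl).1) hlim,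
    limsup_le_of_le_of_tendsto (fun n => ddCost_nonneg _) (fun n => (hcost n _ rfl).2) hlim⟩
  · have hlarge : ∀ᶠ n : ℕ in atTop, 2 / δ ≤ (n : ℝ) :=
      tendsto_natCast_atTop_atTop.eventually_ge_atTop _
    filter_upwards [hlarge, eventually_gt_atTop 0] with n hn hn0
    have hn0' : (0 : ℝ) < n := by exact_mod_cast hn0
    have hjn : (j n : ℝ) < n * (1 - hb τ + δ / 2) + 1 :=
      Nat.ceil_lt_add_one (mul_nonneg hn0'.le (by linarith))
    rw [div_le_iff₀ hδ] at hn
    rw [ge_iff_le, le_div_iff₀ hn0']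
    linarith [hM n]
  · simp [herr]
end
end
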